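/- In the T/Key attack game, any adversary making at most T random-oracle queries wins with probability at most (2T + 2k + 1)/2^n, where n is the password length and k the chain length. -/

import Mathlib

/-- Apply the chain functions `h_i` for indices `i ∈ [lo, hi)` (0-indexed, so
`h ⟨0,_⟩` plays the role of `h₁`) to `x`. -/
def chainSeg {k N : ℕ} (h : Fin k → Fin N → Fin N) (lo hi : ℕ) (x : Fin N) : Fin N :=
  (List.range' lo (hi - lo)).foldl
    (fun y i => if hik : i < k then h ⟨i, hik⟩ y else y) x

/-- The T/Key password at time `t ∈ [1,k]`: `p_t = h_{k−t} ∘ ⋯ ∘ h₁ (sk)`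
(so `p_k = sk` and the initial server value is `p_init = h_{[1,k]}(sk)`). -/
def pwd {k N : ℕ} (h : Fin k → Fin N → Fin N) (sk : Fin N) (t : ℕ) : Fin N :=
  chainSeg h 0 (k - t) sk

/-- An adversary in the T/Key attack game: it may adaptively query the random
oracle (i.e. any of the `k` chain functions obtained from it by domain
separation), request the password for a time `t`, or stop and submit an
impersonation attempt `(t_attack, p_attack)`. -/
inductive Adv (k N : ℕ) : Type
  | output : ℕ → Fin N → Adv k N
  | oquery : Fin k → Fin N → (Fin N → Adv k N) → Adv k N
  | pquery : ℕ → (Fin N → Adv k N) → Adv k N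

namespace Adv

/-- The maximal number of random-oracle queries on any execution path
(password queries are not counted). -/
def roQueries {k N : ℕ} : Adv k N → ℕ
  | output _ _ => 0
  | oquery _ _ cont => 1 + Finset.univ.sup fun y => roQueries (cont y)
  | pquery _ cont => Finset.univ.sup fun y => roQueries (cont y)

/-- Run the game: `m` is the latest password-query time so far (initially `0`).
Password-query times must be monotonically increasing and in `[1,k]`, and the
final impersonation time must exceed all queried times; otherwise the run is
invalid (`none`). -/
def play {k N : ℕ} : Adv k N → (Fin k → Fin N → Fin N) → Fin N → ℕ →
    Option (ℕ × Fin N)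
  | output t p, _, _, m => if m < t ∧ t ≤ k then some (t, p) else none
  | oquery i x cont, h, sk, m => play (cont (h i x)) h sk m
  | pquery t cont, h, sk, m =>
      if m < t ∧ t ≤ k then play (cont (pwd h sk t)) h sk t else none

/-- The adversary wins if its submission `(t, p)` is valid and `p` passes the
server's check: applying the remaining chain functions
`h_{k−t+1}, …, h_k` to `p` yields the stored value `h_{[1,k]}(sk)`. -/
def wins {k N : ℕ} (A : Adv k N) (h : Fin k → Fin N → Fin N) (sk : Fin N) :
    Bool :=
  match play A h sk 0 with
  | some (t, p) => decide (chainSeg h (k - t) k p = chainSeg h 0 k sk)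
  | none => false

end Adv

/-- If `P` is stable under resampling coordinate `c`, then coordinate `c` hits a target that does not
depend on it with probability at most `1 / card α`. -/
theorem card_filter_eq_mul_card_le {ι α : Type*} [Fintype ι] [DecidableEq ι] [Fintype α]
    [DecidableEq α]
    (P : Finset (ι → α)) (c : ι) (hP : ∀ ω ∈ P, ∀ v, Function.update ω c v ∈ P)
    (f : (ι → α) → α) (hf : ∀ ω v, f (Function.update ω c v) = f ω) :
    (P.filter fun ω => ω c = f ω).card * Fintype.card α ≤ P.card := by
  rw [← Finset.card_univ, ← Finset.card_product]
  refine Finset.card_le_card_of_injOn (fun q => Function.update q.1 c q.2) ?_ ?_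
  · rintro ⟨ω, v⟩ h
    simp only [Finset.coe_product, Set.mem_prod, Finset.mem_coe, Finset.mem_filter] at h
    exact hP ω h.1.1 v
  · rintro ⟨ω, v⟩ h ⟨ω', v'⟩ h' e
    simp only [Finset.coe_product, Set.mem_prod, Finset.mem_coe, Finset.mem_filter] at h h'
    simp only at e
    have hv : v = v' := by simpa using congrFun e c
    have hff : f ω = f ω' := by rw [← hf ω v, e, hf]
    have key : ∀ ω₀ : ι → α, ∀ w, ω₀ c = f ω₀ →
        Function.update (Function.update ω₀ c w) c (f ω₀) = ω₀ := by
      intro ω₀ w h0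
      rw [Function.update_idem, ← h0, Function.update_eq_self]
    have : ω = ω' := by rw [← key ω v h.1.2, ← key ω' v' h'.1.2, e, hff]
    rw [this, hv]

/-- A union bound over the value of `f`. -/
theorem card_filter_mul_le_of_fiberwise {Ω α : Type*} [Fintype α]
    [DecidableEq α] (P : Finset Ω) (f : Ω → α)
    (E : α → Ω → Prop) [∀ v, DecidablePred (E v)] (N c : ℕ)
    (h : ∀ v, ((P.filter fun ω => f ω = v).filter (E v)).card * N
      ≤ c * (P.filter fun ω => f ω = v).card) :
    (P.filter fun ω => E (f ω) ω).card * N ≤ c * P.card := by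
  have h1 : (P.filter fun ω => E (f ω) ω).card
      = ∑ v, ((P.filter fun ω => f ω = v).filter (E v)).card := by
    rw [Finset.card_eq_sum_card_fiberwise (f := f) (t := Finset.univ) (by simp)]
    refine Finset.sum_congr rfl fun v _ => congrArg Finset.card ?_
    ext ω
    simp only [Finset.mem_filter]
    constructor
    · rintro ⟨⟨a, b⟩, rfl⟩
      exact ⟨⟨a, rfl⟩, b⟩
    · rintro ⟨⟨a, rfl⟩, b⟩
      exact ⟨⟨a, b⟩, rfl⟩
  have h2 : P.card = ∑ v, (P.filter fun ω => f ω = v).card :=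
    Finset.card_eq_sum_card_fiberwise (by simp)
  rw [h1, h2, Finset.sum_mul, Finset.mul_sum]
  exact Finset.sum_le_sum fun v _ => h v

section ChainSeg

variable {k N : ℕ} (h : Fin k → Fin N → Fin N)

theorem chainSeg_self (l : ℕ) (x : Fin N) : chainSeg h l l x = x := by
  simp [chainSeg]

theorem chainSeg_of_lt {l : ℕ} (hl : l < k) (x : Fin N) :
    chainSeg h l k x = chainSeg h (l + 1) k (h ⟨l, hl⟩ x) := by
  unfold chainSeg
  obtain ⟨d, hd⟩ : ∃ d, k - l = d + 1 := ⟨k - l - 1, by omega⟩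
  rw [hd, show k - (l + 1) = d by omega, List.range'_succ]
  simp [hl]

theorem chainSeg_zero_succ {l : ℕ} (hl : l < k) (x : Fin N) :
    chainSeg h 0 (l + 1) x = h ⟨l, hl⟩ (chainSeg h 0 l x) := by
  simp [chainSeg, List.range'_concat, hl]

end ChainSeg

namespace TKey

/-- Sample space in which the chain `y₀, …, y_k` (right coordinates) is sampled independently of the
values of the chain functions off the chain (left coordinates). -/
abbrev Sample (k N : ℕ) : Type := (Fin k × Fin N) ⊕ Fin (k + 1) → Fin N

namespace Sample

variable {k N : ℕ}

/-- The chain functions, patched along the chain. -/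
def oracle (ω : Sample k N) (i : Fin k) (x : Fin N) : Fin N :=
  if x = ω (.inr i.castSucc) then ω (.inr i.succ) else ω (.inl (i, x))

/-- The secret. -/
def secret (ω : Sample k N) : Fin N := ω (.inr 0)

/-- The oracle answer as it is before levels below `r` of the chain are patched in. -/
def partialOracle (ω : Sample k N) (r : ℕ) (i : Fin k) (x : Fin N) : Fin N :=
  if r ≤ i ∧ x = ω (.inr i.castSucc) then ω (.inr i.succ) else ω (.inl (i, x))

theorem chainSeg_oracle (ω : Sample k N) (l : ℕ) (hl : l < k + 1) :
    chainSeg ω.oracle 0 l ω.secret = ω (.inr ⟨l, hl⟩) := by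
  induction l with
  | zero => exact chainSeg_self _ _ _
  | succ l ih =>
    rw [chainSeg_zero_succ _ (by omega), ih (by omega)]
    simp [oracle]

/-- No value in `K` off the chain maps into the chain. -/
def Clean (K : Set (Fin k × Fin N)) (ω : Sample k N) : Prop :=
  ∀ i x, (i, x) ∈ K → ω (.inl (i, x)) ≠ ω (.inr i.succ)

/-- Membership in `P` only depends on the oracle values in `K` and on the chain from level `r`. -/
def Determined (K : Set (Fin k × Fin N)) (r : ℕ) (P : Finset (Sample k N)) : Prop :=
  (∀ ω ∈ P, ∀ q ∉ K, ∀ v, Function.update ω (.inl q) v ∈ P) ∧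
    ∀ ω ∈ P, ∀ l : Fin (k + 1), (l : ℕ) < r → ∀ v, Function.update ω (.inr l) v ∈ P

/-- If `f` only depends on the oracle values in `K'` and on the chain from level `r'`, so do its
fibers in `P`. -/
theorem Determined.filter {K K' : Set (Fin k × Fin N)} {r r' : ℕ} {P : Finset (Sample k N)}
    (hP : Determined K r P) (hK : K ⊆ K') (hr : r' ≤ r) {α : Type*} [DecidableEq α] (f : Sample k N → α)
    (hf : ∀ ω, ∀ q ∉ K', ∀ v, f (Function.update ω (.inl q) v) = f ω)
    (hf' : ∀ ω, ∀ l : Fin (k + 1), (l : ℕ) < r' → ∀ v, f (Function.update ω (.inr l) v) = f ω)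
    (a : α) : Determined K' r' (P.filter fun ω => f ω = a) := by
  constructor
  · intro ω hω q hq v
    rw [Finset.mem_filter] at hω ⊢
    exact ⟨hP.1 ω hω.1 q (fun h => hq (hK h)) v, by rw [hf ω q hq, hω.2]⟩
  · intro ω hω l hl v
    rw [Finset.mem_filter] at hω ⊢
    exact ⟨hP.2 ω hω.1 l (hl.trans_le hr) v, by rw [hf' ω l hl, hω.2]⟩

open Classical in
/-- A fresh oracle value off the chain maps into the chain with probability at most `1 / N`. -/
theorem Determined.card_collision_mul_le {K : Set (Fin k × Fin N)} {r : ℕ}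
    {P : Finset (Sample k N)} (hP : Determined K r P) (i : Fin k) (x : Fin N) :
    (P.filter fun ω => (i, x) ∉ K ∧ ω (.inl (i, x)) = ω (.inr i.succ)).card * N ≤ P.card := by
  by_cases hK : (i, x) ∈ K
  · simp [hK]
  · simpa [hK] using card_filter_eq_mul_card_le P (.inl (i, x)) (fun ω hω => hP.1 ω hω _ hK)
      (fun ω => ω (.inr i.succ)) (fun ω v => by simp)

open Classical in
/-- An unrevealed chain value is guessed with probability at most `1 / N`. -/
theorem Determined.card_guess_mul_le {K : Set (Fin k × Fin N)} {r : ℕ}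
    {P : Finset (Sample k N)} (hP : Determined K r P) (l : Fin (k + 1)) (x : Fin N) :
    (P.filter fun ω => (l : ℕ) < r ∧ ω (.inr l) = x).card * N ≤ P.card := by
  by_cases hl : (l : ℕ) < r
  · simpa [hl] using card_filter_eq_mul_card_le P (.inr l) (fun ω hω => hP.2 ω hω _ hl)
      (fun _ => x) (fun _ _ => rfl)
  · simp [hl]

theorem Clean.insert {K : Set (Fin k × Fin N)} {ω : Sample k N} (h : Clean K ω) {i : Fin k}
    {x : Fin N} (hx : ω (.inl (i, x)) ≠ ω (.inr i.succ)) : Clean (insert (i, x) K) ω := by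
  rintro j z (hz | hz)
  · obtain ⟨rfl, rfl⟩ := Prod.mk.inj hz
    exact hx
  · exact h j z hz

open Classical in
/-- A chain that starts off the true chain at level `l` merges with it with probability at most
`(k - l) / N`. -/
theorem card_merge_mul_le (d : ℕ) : ∀ (l : ℕ) (hl : l + d = k) (x : Fin N)
    (K : Set (Fin k × Fin N)) (r : ℕ) (P : Finset (Sample k N)), Determined K r P →
    (P.filter fun ω => Clean K ω ∧ ω (.inr ⟨l, by omega⟩) ≠ x ∧
      chainSeg ω.oracle l k x = ω (.inr (Fin.last k))).card * N ≤ d * P.card := by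
  induction d with
  | zero =>
    intro l hl x K r P _
    obtain rfl : l = k := by omega
    rw [Finset.filter_false_of_mem]
    · simp
    · rintro ω _ ⟨_, h1, h2⟩
      rw [chainSeg_self] at h2
      exact h1 h2.symm
  | succ d ih =>
    intro l hl x K r P hP
    have hlk : l < k := by omega
    set i : Fin k := ⟨l, hlk⟩ with hi
    have hfib := card_filter_mul_le_of_fiberwise P (fun ω => ω (.inl (i, x)))
      (fun v ω => Clean (insert (i, x) K) ω ∧ ω (.inr ⟨l + 1, by omega⟩) ≠ v ∧
        chainSeg ω.oracle (l + 1) k v = ω (.inr (Fin.last k))) N d (fun v => by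
          refine ih (l + 1) (by omega) v _ r _ (hP.filter (Set.subset_insert (i, x) K) le_rfl
            (fun ω => ω (.inl (i, x))) ?_ ?_ v)
          · intro ω q hq w
            rw [Function.update_of_ne]
            rintro h
            exact hq (Set.mem_insert_iff.2 (.inl (Sum.inl.inj h).symm))
          · intro ω l _ w
            simp)
    have hcoll := hP.card_collision_mul_le i x
    refine (Nat.mul_le_mul_right N ((Finset.card_le_card ?_).trans
      (Finset.card_union_le _ _))).trans ((add_mul _ _ N).trans_le
        ((add_le_add hfib hcoll).trans_eq (by ring)))
    intro ω hω
    simp only [Finset.mem_union, Finset.mem_filter] at hω ⊢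
    obtain ⟨hωP, hc, hne, hch⟩ := hω
    by_cases hb : ω (.inl (i, x)) = ω (.inr i.succ)
    · exact .inr ⟨hωP, fun h => hc i x h hb, hb⟩
    · refine .inl ⟨hωP, hc.insert hb, fun h => hb h.symm, ?_⟩
      rw [chainSeg_of_lt _ hlk] at hch
      rwa [oracle, if_neg (fun h => hne h.symm)] at hch

/-- The adversary `A`, started after a password query at time `m`, wins against `ω`. -/
def WinsFrom (A : Adv k N) (m : ℕ) (ω : Sample k N) : Prop :=
  ∃ t p, A.play ω.oracle ω.secret m = some (t, p) ∧
    chainSeg ω.oracle (k - t) k p = ω (.inr (Fin.last k))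

open Classical in
theorem card_winsFrom_mul_le (A : Adv k N) : ∀ (m T : ℕ) (K : Set (Fin k × Fin N))
    (P : Finset (Sample k N)), A.roQueries ≤ T → Determined K (k - m) P →
    (P.filter fun ω => Clean K ω ∧ WinsFrom A m ω).card * N ≤ (2 * T + k + 1) * P.card := by
  induction A with
  | output t p =>
    intro m T K P _ hP
    by_cases ht : m < t ∧ t ≤ k
    · have hguess := hP.card_guess_mul_le ⟨k - t, by omega⟩ p
      have hmerge := card_merge_mul_le t (k - t) (by omega) p K _ P hP
      refine (Nat.mul_le_mul_right N ((Finset.card_le_card ?_).trans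
        (Finset.card_union_le _ _))).trans ((add_mul _ _ N).trans_le
          ((add_le_add hguess hmerge).trans ?_))
      · intro ω hω
        simp only [Finset.mem_union, Finset.mem_filter] at hω ⊢
        obtain ⟨hωP, hc, t', p', hplay, hch⟩ := hω
        rw [Adv.play, if_pos ht] at hplay
        obtain ⟨rfl, rfl⟩ := Prod.mk.inj (Option.some.inj hplay)
        by_cases hp : ω (.inr ⟨k - t, by omega⟩) = p
        · exact .inl ⟨hωP, by omega, hp⟩
        · exact .inr ⟨hωP, hc, hp, hch⟩
      · calc P.card + t * P.card = (t + 1) * P.card := by ring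
          _ ≤ _ := Nat.mul_le_mul_right _ (by omega)
    · rw [Finset.filter_false_of_mem]
      · simp
      · rintro ω _ ⟨_, t', p', hplay, _⟩
        simp [Adv.play, ht] at hplay
  | oquery i x cont ih =>
    intro m T K P hT hP
    simp only [Adv.roQueries] at hT
    obtain ⟨T, rfl⟩ : ∃ T', T = T' + 1 := ⟨T - 1, by omega⟩
    have hcont : ∀ v, (cont v).roQueries ≤ T := fun v =>
      (Finset.le_sup (f := fun y => (cont y).roQueries) (Finset.mem_univ v)).trans (by omega)
    have hfib := card_filter_mul_le_of_fiberwise P (fun ω => ω.partialOracle (k - m) i x)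
      (fun v ω => Clean (insert (i, x) K) ω ∧ WinsFrom (cont v) m ω) N (2 * T + k + 1) (fun v => by
          refine ih v m T _ _ (hcont v)
            (hP.filter (Set.subset_insert (i, x) K) le_rfl
              (fun ω => ω.partialOracle (k - m) i x) ?_ ?_ v)
          · intro ω q hq w
            have : (Sum.inl (i, x) : (Fin k × Fin N) ⊕ Fin (k + 1)) ≠ Sum.inl q := fun h =>
              hq (Set.mem_insert_iff.2 (.inl (Sum.inl.inj h).symm))
            simp [partialOracle, Function.update_of_ne this]
          · intro ω l hl w
            by_cases hr : k - m ≤ (i : ℕ)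
            · have h1 : (Sum.inr i.castSucc : (Fin k × Fin N) ⊕ Fin (k + 1)) ≠ Sum.inr l := by
                intro h
                rw [← Sum.inr.inj h, Fin.val_castSucc] at hl
                omega
              have h2 : (Sum.inr i.succ : (Fin k × Fin N) ⊕ Fin (k + 1)) ≠ Sum.inr l := by
                intro h
                rw [← Sum.inr.inj h, Fin.val_succ] at hl
                omega
              simp [partialOracle, Function.update_of_ne h1, Function.update_of_ne h2]
            · simp [partialOracle, hr])
    have hcoll := hP.card_collision_mul_le i x
    have hguess := hP.card_guess_mul_le i.castSucc x
    refine (Nat.mul_le_mul_right N ((Finset.card_le_card ?_).trans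
      ((Finset.card_union_le _ _).trans (Nat.add_le_add_right (Finset.card_union_le _ _) _)))).trans
        (((add_mul _ _ N).trans (congrArg (· + _) (add_mul _ _ N))).trans_le
          ((add_le_add (add_le_add hfib hcoll) hguess).trans_eq (by ring)))
    intro ω hω
    simp only [Finset.mem_union, Finset.mem_filter] at hω ⊢
    obtain ⟨hωP, hc, t, p, hplay, hch⟩ := hω
    by_cases hb : ω (.inl (i, x)) = ω (.inr i.succ)
    · exact .inl (.inr ⟨hωP, fun h => hc i x h hb, hb⟩)
    by_cases ha : (i.castSucc : ℕ) < k - m ∧ ω (.inr i.castSucc) = x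
    · exact .inr ⟨hωP, ha⟩
    refine .inl (.inl ⟨hωP, hc.insert hb, t, p, ?_, hch⟩)
    rw [Adv.play] at hplay
    have : ω.partialOracle (k - m) i x = ω.oracle i x := by
      rw [Fin.val_castSucc] at ha
      unfold partialOracle oracle
      by_cases hx : x = ω (.inr i.castSucc)
      · have : k - m ≤ i := not_lt.1 fun h => ha ⟨h, hx.symm⟩
        simp [this]
      · simp [hx]
    rwa [this]
  | pquery t cont ih =>
    intro m T K P hT hP
    simp only [Adv.roQueries] at hT
    have hcont : ∀ v, (cont v).roQueries ≤ T := fun v =>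
      (Finset.le_sup (f := fun y => (cont y).roQueries) (Finset.mem_univ v)).trans hT
    by_cases ht : m < t ∧ t ≤ k
    · have hfib := card_filter_mul_le_of_fiberwise P (fun ω => ω (.inr ⟨k - t, by omega⟩))
        (fun v ω => Clean K ω ∧ WinsFrom (cont v) t ω) N (2 * T + k + 1) (fun v => by
          refine ih v t T _ _ (hcont v) (hP.filter subset_rfl (by omega)
            (fun ω => ω (.inr ⟨k - t, by omega⟩)) ?_ ?_ v)
          · intro ω q _ w
            simp
          · intro ω l hl w
            rw [Function.update_of_ne]
            intro h
            rw [← Sum.inr.inj h] at hl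
            exact lt_irrefl _ hl)
      refine (Nat.mul_le_mul_right N (Finset.card_le_card ?_)).trans hfib
      intro ω hω
      simp only [Finset.mem_filter] at hω ⊢
      obtain ⟨hωP, hc, t', p, hplay, hch⟩ := hω
      rw [Adv.play, if_pos ht, pwd, chainSeg_oracle ω (k - t) (by omega)] at hplay
      exact ⟨hωP, hc, t', p, hplay, hch⟩
    · rw [Finset.filter_false_of_mem]
      · simp
      · rintro ω _ ⟨_, t', p', hplay, _⟩
        simp [Adv.play, ht] at hplay

/-- The sample with chain functions `h`, secret `sk`, and off-chain table overwritten by `z` along the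
chain. -/
def ofGame (h : Fin k → Fin N → Fin N) (sk : Fin N) (z : Fin k → Fin N) : Sample k N :=
  Sum.elim (fun q => if q.2 = chainSeg h 0 q.1 sk then z q.1 else h q.1 q.2)
    (fun l => chainSeg h 0 l sk)

variable (h : Fin k → Fin N → Fin N) (sk : Fin N) (z : Fin k → Fin N)

theorem secret_ofGame : (ofGame h sk z).secret = sk := chainSeg_self h 0 sk

theorem oracle_ofGame : (ofGame h sk z).oracle = h := by
  funext i x
  by_cases hx : x = chainSeg h 0 i sk
  · simp [oracle, ofGame, ← hx, chainSeg_zero_succ h i.isLt]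
  · simp [oracle, ofGame, hx]

theorem ofGame_inl_chain (i : Fin k) : ofGame h sk z (.inl (i, chainSeg h 0 i sk)) = z i := by
  simp [ofGame]

theorem ofGame_injective :
    Function.Injective fun q : ((Fin k → Fin N → Fin N) × Fin N) × (Fin k → Fin N) =>
      ofGame q.1.1 q.1.2 q.2 := by
  rintro ⟨⟨h, sk⟩, z⟩ ⟨⟨h', sk'⟩, z'⟩ e
  simp only at e
  obtain rfl : h = h' := by rw [← oracle_ofGame h sk z, e, oracle_ofGame]
  obtain rfl : sk = sk' := by rw [← secret_ofGame h sk z, e, secret_ofGame]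
  obtain rfl : z = z' := by
    funext i
    rw [← ofGame_inl_chain h sk z, e, ofGame_inl_chain]
  rfl

theorem winsFrom_ofGame (A : Adv k N) (hw : A.wins h sk = true) :
    WinsFrom A 0 (ofGame h sk z) := by
  unfold Adv.wins at hw
  unfold WinsFrom
  rw [oracle_ofGame, secret_ofGame]
  split at hw
  · rename_i t p heq
    exact ⟨t, p, heq, of_decide_eq_true hw⟩
  · exact absurd hw (by simp)

end Sample

/-- The game bound, in counting form. -/
theorem card_wins_mul_le {k N : ℕ} (hN : 0 < N) (T : ℕ) (A : Adv k N) (hT : A.roQueries ≤ T) :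
    (Finset.univ.filter fun p : (Fin k → Fin N → Fin N) × Fin N => A.wins p.1 p.2 = true).card * N
      ≤ (2 * T + k + 1) * Fintype.card ((Fin k → Fin N → Fin N) × Fin N) := by
  classical
  have hmain := Sample.card_winsFrom_mul_le A 0 T ∅ Finset.univ hT
    ⟨fun _ _ _ _ _ => Finset.mem_univ _, fun _ _ _ _ _ => Finset.mem_univ _⟩
  have hinj : (Finset.univ.filter fun p : (Fin k → Fin N → Fin N) × Fin N =>
      A.wins p.1 p.2 = true).card * N ^ k ≤
        (Finset.univ.filter fun ω : Sample k N =>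
          Sample.Clean ∅ ω ∧ Sample.WinsFrom A 0 ω).card := by
    have hcard : N ^ k = (Finset.univ : Finset (Fin k → Fin N)).card := by simp
    rw [hcard, ← Finset.card_product]
    refine Finset.card_le_card_of_injOn _ ?_ Sample.ofGame_injective.injOn
    rintro ⟨⟨h, sk⟩, z⟩ hq
    simp only [Finset.coe_product, Set.mem_prod, Finset.mem_coe, Finset.mem_filter] at hq ⊢
    exact ⟨Finset.mem_univ _, fun _ _ hx => absurd hx (Set.notMem_empty _),
      Sample.winsFrom_ofGame h sk z A hq.1.2⟩
  have hΩ : (Finset.univ : Finset (Sample k N)).card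
      = Fintype.card ((Fin k → Fin N → Fin N) × Fin N) * N ^ k := by
    simp [Sample, pow_add, pow_mul, pow_right_comm]
    ring
  rw [hΩ] at hmain
  refine Nat.le_of_mul_le_mul_right ?_ (pow_pos hN k)
  calc _ = _ * N ^ k * N := by ring
    _ ≤ _ := Nat.mul_le_mul_right N hinj
    _ ≤ _ := hmain
    _ = _ := by ring

end TKey

/-- In the T/Key attack game with password length `n` and
chain length `k` (the chain functions being `k` independent uniformly random
functions on `{0,1}^n`, and the secret `sk` uniformly random), any adversary
making at most `T` random-oracle queries wins with probability at most
`(2T + 2k + 1)/2^n`. -/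
theorem stmt16 (n k T : ℕ) (hk : 0 < k) (A : Adv k (2 ^ n))
    (hT : A.roQueries ≤ T) :
    ((Finset.univ.filter
        (fun p : (Fin k → Fin (2 ^ n) → Fin (2 ^ n)) × Fin (2 ^ n) =>
          A.wins p.1 p.2 = true)).card : ℝ) /
      (Fintype.card ((Fin k → Fin (2 ^ n) → Fin (2 ^ n)) × Fin (2 ^ n)))
      ≤ (2 * T + 2 * k + 1) / 2 ^ n := by
  have hN : 0 < 2 ^ n := by positivity
  have hmain := TKey.card_wins_mul_le hN T A hT
  have : Nonempty (Fin (2 ^ n)) := ⟨⟨0, hN⟩⟩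
  rw [div_le_div_iff₀ (by exact_mod_cast Fintype.card_pos) (by positivity)]
  have hcast := (Nat.cast_le (α := ℝ)).2 hmain
  push_cast at hcast
  refine hcast.trans (mul_le_mul_of_nonneg_right ?_ (Nat.cast_nonneg _))
  have : (0 : ℝ) ≤ k := k.cast_nonneg
  linarith
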